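/- arXiv:1712.03583 — 2 statements merged into one kernel-verified Lean document; each statement's English description precedes it below -/
import Mathlib

section
/- Let C ⊆ ℝ^n be a nonempty convex compact set and let Φ : C ⇉ C be a lower semicontinuous set-valued map with nonempty convex values. Then Φ has a fixed point, i.e. there exists x ∈ C with x ∈ Φ(x). -/
open Set Topology Filter

/-- A set-valued map `Φ : X ⇉ Y` is lower semicontinuous at `x` if for every open set `Ω`
with `Φ x ∩ Ω ≠ ∅` there is a neighborhood of `x` on which `Φ x' ∩ Ω ≠ ∅`. -/
def LscAt {X Y : Type*} [TopologicalSpace X] [TopologicalSpace Y]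
    (Φ : X → Set Y) (x : X) : Prop :=
  ∀ Ω : Set Y, IsOpen Ω → (Φ x ∩ Ω).Nonempty → ∀ᶠ x' in 𝓝 x, (Φ x' ∩ Ω).Nonempty

section Brouwer

open MeasureTheory Metric
open scoped NNReal RealInnerProductSpace

/-- The polynomial `t ↦ det (1 + t A)` is determined by its values at `finrank ℝ E + 1` nodes. -/
theorem det_one_add_eq_sum_lagrange {E : Type*} [NormedAddCommGroup E] [NormedSpace ℝ E]
    [FiniteDimensional ℝ E] (v : ℕ → ℝ) (hv : Function.Injective v) (A : E →L[ℝ] E) :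
    (1 + A).det = ∑ i ∈ Finset.range (Module.finrank ℝ E + 1),
      (Lagrange.basis (Finset.range (Module.finrank ℝ E + 1)) v i).eval 1 *
        (1 + v i • A).det := by
  set b := Module.finBasis ℝ E
  set M := LinearMap.toMatrix b b (A : E →ₗ[ℝ] E)
  set P : Polynomial ℝ :=
    Matrix.det ((Polynomial.X : Polynomial ℝ) • M.map Polynomial.C +
      (1 : Matrix _ _ ℝ).map Polynomial.C)
  have hdeg : P.natDegree ≤ Module.finrank ℝ E := by
    simpa only [Fintype.card_fin] using Polynomial.natDegree_det_X_add_C_le M 1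
  have hP (t : ℝ) : (1 + t • A).det = P.eval t := by
    have h1 : (1 + t • A).det = (1 + t • M).det := by
      rw [ContinuousLinearMap.det, ← LinearMap.det_toMatrix b]
      congr 1
      simp [M, LinearMap.toMatrix_one]
    rw [h1, ← Polynomial.coe_evalRingHom, RingHom.map_det]
    congr 1
    ext i j
    by_cases hij : i = j <;> simp [hij, mul_comm t, add_comm]
  have hint := Lagrange.eq_interpolate (s := Finset.range (Module.finrank ℝ E + 1)) (v := v)
    (f := P) hv.injOn (by
      rw [Finset.card_range]
      exact (Polynomial.degree_le_natDegree).trans_lt (by exact_mod_cast Nat.lt_succ_of_le hdeg))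
  have h1 := hP 1
  rw [one_smul] at h1
  rw [h1, hint, Lagrange.interpolate_apply, Polynomial.eval_finsetSum]
  refine Finset.sum_congr rfl fun i _ => ?_
  rw [Polynomial.eval_mul, Polynomial.eval_C, hP, mul_comm]

theorem sum_eval_lagrange_basis (n : ℕ) (v : ℕ → ℝ) (hv : Function.Injective v) (x : ℝ) :
    ∑ i ∈ Finset.range (n + 1), (Lagrange.basis (Finset.range (n + 1)) v i).eval x = 1 := by
  rw [← Polynomial.eval_finsetSum, Lagrange.sum_basis hv.injOn ⟨0, by simp⟩, Polynomial.eval_one]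

theorem det_one_add_pos {E : Type*} [NormedAddCommGroup E] [NormedSpace ℝ E]
    [FiniteDimensional ℝ E] (A : E →L[ℝ] E) (hA : ‖A‖ < 1) : 0 < (1 + A).det := by
  have hne (s : ℝ) (hs : s ∈ Icc (0 : ℝ) 1) : (1 + s • A).det ≠ 0 := by
    intro h0
    obtain ⟨x, hx, hx0⟩ :=
      (Submodule.ne_bot_iff _).1 (LinearMap.bot_lt_ker_of_det_eq_zero h0).ne'
    have h1 : x = -(s • A x) := by
      have : x + s • A x = 0 := by simpa using hx
      exact eq_neg_of_add_eq_zero_left this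
    have h2 : ‖x‖ ≤ ‖A‖ * ‖x‖ := by
      conv_lhs => rw [h1, norm_neg, norm_smul, Real.norm_of_nonneg hs.1]
      calc s * ‖A x‖ ≤ 1 * ‖A x‖ := by gcongr; exact hs.2
        _ ≤ ‖A‖ * ‖x‖ := by rw [one_mul]; exact A.le_opNorm x
    have : 0 < ‖x‖ := norm_pos_iff.2 hx0
    nlinarith
  by_contra! hneg
  have hc : ContinuousOn (fun s : ℝ => (1 + s • A).det) (Icc 0 1) :=
    (ContinuousLinearMap.continuous_det.comp (by fun_prop)).continuousOn
  have := intermediate_value_Icc' (zero_le_one) hc (show (0 : ℝ) ∈ _ by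
    simpa [ContinuousLinearMap.det] using hneg)
  obtain ⟨s, hs, h⟩ := this
  exact hne s hs h

section Jacobian

variable {E : Type*} [NormedAddCommGroup E] [NormedSpace ℝ E] [FiniteDimensional ℝ E]

/-- A Lipschitz perturbation of the identity with small constant is bijective. -/
theorem bijective_id_add_smul {h : E → E} {K : ℝ≥0} (hK : LipschitzWith K h) {t : ℝ} (ht : 0 ≤ t)
    (htK : t * K < 1) : Function.Bijective fun x => x + t • h x := by
  lift t to ℝ≥0 using ht
  have key (y : E) : ContractingWith (t * K) (fun x => y - (t : ℝ) • h x) := by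
    refine ⟨by exact_mod_cast htK, LipschitzWith.of_dist_le_mul fun a b => ?_⟩
    rw [dist_sub_left, dist_smul₀, Real.norm_of_nonneg t.coe_nonneg, NNReal.coe_mul, mul_assoc]
    gcongr
    exact hK.dist_le_mul a b
  constructor
  · intro a b hab
    refine (key (a + (t : ℝ) • h a)).fixedPoint_unique' (x := a) (y := b) ?_ ?_
    · simp [Function.IsFixedPt]
    · simp only at hab
      simp [Function.IsFixedPt, hab]
  · intro y
    have := (key y).fixedPoint_isFixedPt
    rw [Function.IsFixedPt] at this
    exact ⟨_, (sub_eq_iff_eq_add.1 this).symm⟩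

variable [MeasurableSpace E] [BorelSpace E] (μ : Measure E)

theorem integrableOn_det_one_add_smul_fderiv {h : E → E} {K : ℝ≥0} (hK : LipschitzWith K h)
    {s : Set E} (hs : μ s ≠ ⊤) (t : ℝ) :
    IntegrableOn (fun x => (1 + t • fderiv ℝ h x).det) s μ := by
  have hdet : Continuous fun A : E →L[ℝ] E => (1 + t • A).det :=
    ContinuousLinearMap.continuous_det.comp (by fun_prop)
  obtain ⟨C, hC⟩ := ((isCompact_closedBall (0 : E →L[ℝ] E) K).image hdet).isBounded.exists_norm_le
  refine IntegrableOn.of_bound hs.lt_top ?_ C ?_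
  · exact (hdet.measurable.comp (measurable_fderiv ℝ h)).aestronglyMeasurable
  · exact Eventually.of_forall fun x => hC _ ⟨_, by
      simpa using norm_fderiv_le_of_lipschitz ℝ hK, rfl⟩

/-- If `h` is Lipschitz, vanishes outside `s` and is differentiable in `s`, then the integral of the
Jacobian of `id + h` over `s` is the volume of `s`. -/
theorem setIntegral_det_one_add_fderiv [μ.IsAddHaarMeasure] {h : E → E} {K : ℝ≥0}
    (hK : LipschitzWith K h)
    {s : Set E} (hs : MeasurableSet s) (hμ : μ s ≠ ⊤) (hd : ∀ x ∈ s, DifferentiableAt ℝ h x)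
    (h0 : ∀ x ∉ s, h x = 0) : ∫ x in s, (1 + fderiv ℝ h x).det ∂μ = μ.real s := by
  have small (t : ℝ) (ht : 0 ≤ t) (htK : t * K < 1) :
      ∫ x in s, (1 + t • fderiv ℝ h x).det ∂μ = μ.real s := by
    have hbij := bijective_id_add_smul hK ht htK
    have himg : (fun x => x + t • h x) '' s = s := by
      have hc : (fun x => x + t • h x) '' sᶜ = sᶜ := by
        rw [image_congr (g := id) (fun x hx => by simp [h0 x hx]), image_id]
      rw [image_compl_eq hbij] at hc
      exact compl_injective hc
    have hcv := integral_image_eq_integral_abs_det_fderiv_smul μ hs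
      (f := fun x => x + t • h x) (f' := fun x => 1 + t • fderiv ℝ h x)
      (fun x hx => (((hasFDerivAt_id x).add
        ((hd x hx).hasFDerivAt.const_smul t))).hasFDerivWithinAt) hbij.1.injOn (fun _ => (1 : ℝ))
    rw [himg] at hcv
    simp only [integral_const, smul_eq_mul, mul_one, measureReal_restrict_apply_univ] at hcv
    rw [hcv]
    refine setIntegral_congr_fun hs fun x _ => (abs_of_pos (det_one_add_pos _ ?_)).symm
    rw [norm_smul, Real.norm_of_nonneg ht]
    refine lt_of_le_of_lt ?_ htK
    gcongr
    exact norm_fderiv_le_of_lipschitz ℝ hK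
  set v : ℕ → ℝ := fun i => ((i + 1 : ℝ) * (K + 1))⁻¹
  have hv : Function.Injective v := by
    intro i j hij
    have : (K + 1 : ℝ) ≠ 0 := by positivity
    exact_mod_cast add_right_cancel (mul_right_cancel₀ this (inv_injective hij))
  have hvs (i : ℕ) : ∫ x in s, (1 + v i • fderiv ℝ h x).det ∂μ = μ.real s := by
    refine small _ (by positivity) ?_
    rw [inv_mul_lt_iff₀ (by positivity)]
    have hi : (0 : ℝ) ≤ i := Nat.cast_nonneg i
    nlinarith [K.coe_nonneg, mul_nonneg hi K.coe_nonneg]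
  rw [setIntegral_congr_fun hs fun x _ => det_one_add_eq_sum_lagrange v hv (fderiv ℝ h x),
    integral_finsetSum]
  · simp_rw [integral_const_mul, hvs, ← Finset.sum_mul, sum_eval_lagrange_basis _ v hv, one_mul]
  · exact fun i _ => (integrableOn_det_one_add_smul_fderiv μ hK hμ _).const_mul _

end Jacobian

/-- A Lipschitz map on the closed unit ball vanishing on the unit sphere extends by zero. -/
theorem LipschitzOnWith.lipschitzWith_indicator_closedBall {E F : Type*} [NormedAddCommGroup E]
    [NormedSpace ℝ E] [NormedAddCommGroup F] {h : E → F} {K : ℝ≥0}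
    (hK : LipschitzOnWith K h (closedBall 0 1)) (h0 : ∀ x, ‖x‖ = 1 → h x = 0) :
    LipschitzWith K ((closedBall (0 : E) 1).indicator h) := by
  classical
  have cross (x y : E) (hx : x ∈ closedBall (0 : E) 1) (hy : y ∉ closedBall (0 : E) 1) :
      dist (h x) 0 ≤ K * dist x y := by
    have hx' : ‖x‖ ≤ 1 := by simpa using hx
    have hy' : 1 ≤ ‖y‖ := by simpa using (not_le.1 (by simpa using hy) : 1 < ‖y‖).le
    obtain ⟨z, hz, hz1⟩ := (convex_segment x y).isPreconnected.intermediate_value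
      (left_mem_segment ℝ x y) (right_mem_segment ℝ x y) continuous_norm.continuousOn
      (show (1 : ℝ) ∈ Icc ‖x‖ ‖y‖ from ⟨hx', hy'⟩)
    calc dist (h x) 0 = dist (h x) (h z) := by rw [h0 z hz1]
      _ ≤ K * dist x z := hK.dist_le_mul x hx z (by simp [hz1])
      _ ≤ K * dist x y := by
        gcongr
        rw [← dist_add_dist_of_mem_segment hz]
        exact le_add_of_nonneg_right dist_nonneg
  refine LipschitzWith.of_dist_le_mul fun x y => ?_
  by_cases hx : x ∈ closedBall (0 : E) 1 <;> by_cases hy : y ∈ closedBall (0 : E) 1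
  · rw [indicator_of_mem hx, indicator_of_mem hy]
    exact hK.dist_le_mul x hx y hy
  · rw [indicator_of_mem hx, indicator_of_notMem hy]
    exact cross x y hx hy
  · rw [indicator_of_notMem hx, indicator_of_mem hy, dist_comm, dist_comm x]
    exact cross y x hy hx
  · rw [indicator_of_notMem hx, indicator_of_notMem hy, dist_self]
    positivity

variable {E : Type*} [NormedAddCommGroup E] [InnerProductSpace ℝ E] [FiniteDimensional ℝ E]

theorem det_fderiv_eq_zero_of_norm_eq_one {r : E → E} {r' : E →L[ℝ] E} {x : E}
    (hr : HasFDerivAt r r' x) (h1 : ∀ᶠ y in 𝓝 x, ‖r y‖ = 1) : r'.det = 0 := by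
  by_contra hdet
  have hsurj : Function.Surjective r' :=
    (LinearMap.equivOfDetNeZero (r' : E →ₗ[ℝ] E) hdet).surjective
  obtain ⟨v, hv⟩ := hsurj (r x)
  have hφ : HasFDerivAt (fun y => ‖r y‖ ^ 2) (0 : E →L[ℝ] ℝ) x :=
    (hasFDerivAt_const (1 : ℝ) x).congr_of_eventuallyEq
      (h1.mono fun y hy => by simp [hy])
  have := congrArg (fun L : E →L[ℝ] ℝ => L v) (hr.norm_sq.unique hφ)
  simp [hv, h1.self_of_nhds] at this

/-- There is no Lipschitz retraction, differentiable inside the ball, from the closed unit ball to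
the unit sphere. -/
theorem not_retraction_closedBall {h : E → E} {K : ℝ≥0}
    (hK : LipschitzOnWith K h (closedBall 0 1)) (h0 : ∀ x, ‖x‖ = 1 → h x = 0)
    (hd : ∀ x ∈ ball (0 : E) 1, DifferentiableAt ℝ h x)
    (h1 : ∀ x ∈ ball (0 : E) 1, ‖x + h x‖ = 1) : False := by
  borelize E
  let μ : Measure E := Measure.addHaar
  set g := (closedBall (0 : E) 1).indicator h
  have hg (x : E) (hx : x ∈ ball (0 : E) 1) : g =ᶠ[𝓝 x] h :=
    eventuallyEq_of_mem (isOpen_ball.mem_nhds hx)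
      fun y hy => indicator_of_mem (ball_subset_closedBall hy) _
  have hint := setIntegral_det_one_add_fderiv μ (hK.lipschitzWith_indicator_closedBall h0)
    measurableSet_ball measure_ball_lt_top.ne
    (fun x hx => (hd x hx).congr_of_eventuallyEq (hg x hx)) (fun x hx => by
      by_cases hx' : x ∈ closedBall (0 : E) 1
      · rw [indicator_of_mem hx']
        exact h0 x (le_antisymm (by simpa using hx') (by simpa using hx))
      · exact indicator_of_notMem hx' _)
  rw [setIntegral_eq_zero_of_forall_eq_zero] at hint
  · exact (ENNReal.toReal_pos (measure_ball_pos μ 0 one_pos).ne' measure_ball_lt_top.ne).ne hint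
  · intro x hx
    rw [(hg x hx).fderiv_eq]
    exact det_fderiv_eq_zero_of_norm_eq_one
      ((hasFDerivAt_id x).add (hd x hx).hasFDerivAt)
      (eventually_of_mem (isOpen_ball.mem_nhds hx) h1)

theorem exists_fixedPoint_of_contDiff {F : E → E} (hF : ContDiff ℝ 1 F)
    (hlt : ∀ x ∈ closedBall (0 : E) 1, ‖F x‖ < 1) : ∃ x ∈ closedBall (0 : E) 1, F x = x := by
  by_contra! hne
  set u : E → E := fun x => x - F x
  have hu (x : E) (hx : x ∈ closedBall (0 : E) 1) : 0 < ‖u x‖ ^ 2 := by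
    have : u x ≠ 0 := sub_ne_zero.2 (hne x hx).symm
    positivity
  set D : E → ℝ := fun x => ⟪x, u x⟫ ^ 2 + ‖u x‖ ^ 2 * (1 - ‖x‖ ^ 2)
  have hsphere (x : E) (hx : ‖x‖ = 1) : 0 < ⟪x, u x⟫ := by
    have h1 := real_inner_le_norm x (F x)
    have h2 := hlt x (by simp [hx])
    simp only [u, inner_sub_right, real_inner_self_eq_norm_sq, hx] at *
    linarith
  have hD (x : E) (hx : x ∈ closedBall (0 : E) 1) : 0 < D x := by
    have hx' : ‖x‖ ≤ 1 := by simpa using hx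
    rcases hx'.eq_or_lt with h | h
    · have := hsphere x h
      simp only [D, h]
      positivity
    · have := hu x hx
      have : 0 < 1 - ‖x‖ ^ 2 := by nlinarith [norm_nonneg x]
      positivity
  set c : E → ℝ := fun x => (-⟪x, u x⟫ + √(D x)) / ‖u x‖ ^ 2
  have hcu : ∀ x ∈ closedBall (0 : E) 1, ContDiffAt ℝ 1 (fun x => c x • u x) x := by
    intro x hx
    have hu' : ContDiffAt ℝ 1 u x := (contDiff_id.sub hF).contDiffAt
    have hi : ContDiffAt ℝ 1 (fun x => ⟪x, u x⟫) x := contDiffAt_id.inner ℝ hu'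
    have hD' : ContDiffAt ℝ 1 D x :=
      (hi.pow 2).add ((hu'.norm_sq ℝ).mul (contDiffAt_const.sub (contDiffAt_id.norm_sq ℝ)))
    exact ((hi.neg.add (hD'.sqrt (hD x hx).ne')).div (hu'.norm_sq ℝ) (hu x hx).ne').smul hu'
  obtain ⟨K, hK⟩ := ContDiffOn.exists_lipschitzOnWith (s := closedBall (0 : E) 1)
    (fun x hx => (hcu x hx).contDiffWithinAt) one_ne_zero (convex_closedBall _ _)
    (isCompact_closedBall _ _)
  refine not_retraction_closedBall hK (fun x hx => ?_)
    (fun x hx => (hcu x (ball_subset_closedBall hx)).differentiableAt one_ne_zero) fun x hx => ?_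
  · have : D x = ⟪x, u x⟫ ^ 2 := by simp [D, hx]
    simp [c, this, Real.sqrt_sq (hsphere x hx).le]
  · have hx := ball_subset_closedBall hx
    have hsq := Real.sq_sqrt (hD x hx).le
    have hc : c x * ‖u x‖ ^ 2 = -⟪x, u x⟫ + √(D x) := div_mul_cancel₀ _ (hu x hx).ne'
    have hs : √(D x) = c x * ‖u x‖ ^ 2 + ⟪x, u x⟫ := by linarith
    have : ‖x + c x • u x‖ ^ 2 = 1 := by
      rw [norm_add_sq_real, real_inner_smul_right, norm_smul, mul_pow, Real.norm_eq_abs, sq_abs]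
      rw [hs] at hsq
      simp only [D] at hsq
      have := hu x hx
      apply mul_left_cancel₀ this.ne'
      linear_combination hsq
    exact (pow_eq_one_iff_of_nonneg (norm_nonneg _) two_ne_zero).1 this

/-- **Brouwer's fixed point theorem** for the closed unit ball. -/
theorem exists_fixedPoint_closedBall {f : E → E} (hf : Continuous f) (hle : ∀ x, ‖f x‖ ≤ 1) :
    ∃ x, f x = x := by
  by_contra! hne
  obtain ⟨x₀, -, hx₀⟩ := (isCompact_closedBall (0 : E) 1).exists_isMinOn ⟨0, by simp⟩
    (hf.dist continuous_id).continuousOn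
  set δ := dist (f x₀) x₀
  have hδ : 0 < δ := dist_pos.2 (hne x₀)
  have hδx (x : E) (hx : x ∈ closedBall (0 : E) 1) : δ ≤ dist (f x) x := hx₀ hx
  obtain ⟨ε, hε, hε1, hεδ⟩ : ∃ ε : ℝ, 0 < ε ∧ ε ≤ 1 ∧ 2 * ε ≤ δ :=
    ⟨min 1 (δ / 2), by positivity, min_le_left _ _, by linarith [min_le_right 1 (δ / 2)]⟩
  obtain ⟨g, hg⟩ := exists_contMDiffMap_forall_mem_convex_of_local_const (n := 1)
    (modelWithCornersSelf ℝ E) (t := fun x => ball ((1 - ε) • f x) ε)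
    (fun x => convex_ball _ _) (fun x => ⟨(1 - ε) • f x, by
      have : Continuous fun y => dist ((1 - ε) • f x) ((1 - ε) • f y) := by fun_prop
      exact (this.tendsto x).eventually_lt_const (by simpa using hε)⟩)
  have hsm (x : E) : ‖(1 - ε) • f x‖ ≤ 1 - ε := by
    rw [norm_smul, Real.norm_of_nonneg (by linarith)]
    exact mul_le_of_le_one_right (by linarith) (hle x)
  obtain ⟨x, hx, hgx⟩ := exists_fixedPoint_of_contDiff (F := g) g.contMDiff.contDiff
    fun x _ => by
      have h1 := hsm x
      have h2 := mem_ball_iff_norm.1 (hg x)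
      have h3 := norm_le_norm_add_norm_sub' (g x) ((1 - ε) • f x)
      linarith
  have h1 := mem_ball_iff_norm'.1 (hg x)
  rw [hgx] at h1
  have h2 : dist (f x) x ≤ ‖(1 - ε) • f x - x‖ + ‖ε • f x‖ := by
    rw [dist_eq_norm]
    refine le_of_eq_of_le (congrArg norm ?_) (norm_add_le _ _)
    module
  have h3 : ‖ε • f x‖ ≤ ε := by
    rw [norm_smul, Real.norm_of_nonneg hε.le]
    exact mul_le_of_le_one_right hε.le (hle x)
  linarith [hδx x hx]

/-- A bounded continuous self-map of a finite-dimensional space has a fixed point. -/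
theorem exists_fixedPoint_of_isBounded_range {V : Type*} [NormedAddCommGroup V] [NormedSpace ℝ V]
    [FiniteDimensional ℝ V] {f : V → V} (hf : Continuous f)
    (hb : Bornology.IsBounded (range f)) : ∃ x, f x = x := by
  let e : V ≃L[ℝ] EuclideanSpace ℝ (Fin (Module.finrank ℝ V)) := toEuclidean
  obtain ⟨R, hR, hRb⟩ := (e.lipschitz.isBounded_image hb).exists_pos_norm_le
  obtain ⟨x, hx⟩ := exists_fixedPoint_closedBall (f := fun x => R⁻¹ • e (f (e.symm (R • x))))
    (by fun_prop) fun x => by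
      rw [norm_smul, norm_inv, Real.norm_of_nonneg hR.le, inv_mul_le_one₀ hR]
      exact hRb _ ⟨_, ⟨_, rfl⟩, rfl⟩
  refine ⟨e.symm (R • x), e.injective ?_⟩
  rw [e.apply_symm_apply]
  exact (inv_smul_eq_iff₀ hR.ne').1 hx

end Brouwer

section Selection

open Metric

theorem LscAt.inter_ball {X E : Type*} [TopologicalSpace X] [PseudoMetricSpace E]
    {Φ : X → Set E} {x : X} (hΦ : LscAt Φ x) {g : X → E}
    (hg : ContinuousAt g x) (ε : ℝ) : LscAt (fun x => Φ x ∩ ball (g x) ε) x := by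
  rintro Ω hΩ ⟨y, ⟨hyΦ, hyb⟩, hyΩ⟩
  obtain ⟨s, hs, hsε⟩ := exists_between (mem_ball.1 hyb)
  filter_upwards [hΦ (Ω ∩ ball (g x) s) (hΩ.inter isOpen_ball) ⟨y, hyΦ, hyΩ, hs⟩,
    hg.eventually (ball_mem_nhds (g x) (sub_pos.2 hsε))] with x' ⟨z, hzΦ, hzΩ, hzs⟩ hx'
  refine ⟨z, ⟨hzΦ, ?_⟩, hzΩ⟩
  have h1 := dist_triangle_right z (g x') (g x)
  rw [mem_ball] at *
  linarith

open scoped Classical in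
theorem LscAt.ite_inter {X Y : Type*} [TopologicalSpace X] [TopologicalSpace Y] {Φ : X → Set Y}
    {x : X} (hΦ : LscAt Φ x) {F : Set X} (hF : IsClosed F) {B : Set Y} (hB : IsOpen B) :
    LscAt (fun x => if x ∈ F then Φ x ∩ B else Φ x) x := by
  intro Ω hΩ hne
  by_cases hx : x ∈ F
  · simp only [hx, if_true, inter_assoc] at hne
    filter_upwards [hΦ (B ∩ Ω) (hB.inter hΩ) hne] with x' h
    split_ifs
    · rwa [inter_assoc]
    · exact h.mono (inter_subset_inter_right _ inter_subset_right)
  · simp only [hx, if_false] at hne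
    filter_upwards [hΦ Ω hΩ hne, hF.isOpen_compl.mem_nhds hx] with x' h hx'
    rwa [if_neg hx']

variable {X E : Type*} [MetricSpace X] [NormedAddCommGroup E] [NormedSpace ℝ E]

/-- A lower semicontinuous map with nonempty convex values has continuous approximate
selections. -/
theorem exists_continuousMap_inter_ball_nonempty {Φ : X → Set E} (hlsc : ∀ x, LscAt Φ x)
    (hne : ∀ x, (Φ x).Nonempty) (hconv : ∀ x, Convex ℝ (Φ x)) {ε : ℝ} (hε : 0 < ε) :
    ∃ g : C(X, E), ∀ x, (Φ x ∩ ball (g x) ε).Nonempty := by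
  obtain ⟨g, hg⟩ := exists_continuous_forall_mem_convex_of_local_const
    (t := fun x => thickening ε (Φ x)) (fun x => (hconv x).thickening ε) fun x => by
      obtain ⟨y, hy⟩ := hne x
      refine ⟨y, (hlsc x (ball y ε) isOpen_ball ⟨y, hy, mem_ball_self hε⟩).mono ?_⟩
      rintro x' ⟨z, hz, hzy⟩
      exact mem_thickening_iff.2 ⟨z, hz, mem_ball'.1 hzy⟩
  refine ⟨g, fun x => ?_⟩
  obtain ⟨z, hz, hzg⟩ := mem_thickening_iff.1 (hg x)
  exact ⟨z, hz, mem_ball'.2 hzg⟩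

/-- **Michael's selection theorem**: a lower semicontinuous map with nonempty convex values has a
continuous selection of the closures of its values. -/
theorem exists_continuousMap_mem_closure [CompleteSpace E] {Φ : X → Set E}
    (hlsc : ∀ x, LscAt Φ x) (hne : ∀ x, (Φ x).Nonempty) (hconv : ∀ x, Convex ℝ (Φ x)) :
    ∃ g : C(X, E), ∀ x, g x ∈ closure (Φ x) := by
  have step (n : ℕ) (g : {g : C(X, E) // ∀ x, (Φ x ∩ ball (g x) (1 / 2 ^ n)).Nonempty}) :
      ∃ g' : {g : C(X, E) // ∀ x, (Φ x ∩ ball (g x) (1 / 2 ^ (n + 1))).Nonempty},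
        ∀ x, dist (g.1 x) (g'.1 x) ≤ 4 / 2 / 2 ^ n := by
    obtain ⟨g', hg'⟩ := exists_continuousMap_inter_ball_nonempty
      (fun x => (hlsc x).inter_ball g.1.continuous.continuousAt (1 / 2 ^ n)) g.2
      (fun x => (hconv x).inter (convex_ball _ _))
      (show (0 : ℝ) < 1 / 2 ^ (n + 1) by positivity)
    refine ⟨⟨g', fun x => (hg' x).mono (inter_subset_inter_left _ inter_subset_left)⟩, fun x => ?_⟩
    obtain ⟨z, ⟨-, hz⟩, hz'⟩ := hg' x
    have h1 := dist_triangle_left (g.1 x) (g' x) z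
    have h2 : (1 : ℝ) / 2 ^ (n + 1) ≤ 1 / 2 ^ n := by
      gcongr
      · norm_num
      · omega
    have h3 : (4 : ℝ) / 2 / 2 ^ n = 1 / 2 ^ n + 1 / 2 ^ n := by ring
    rw [mem_ball] at hz hz'
    change dist (g.1 x) (g' x) ≤ _
    linarith
  choose next hnext using step
  obtain ⟨g₀, hg₀⟩ := exists_continuousMap_inter_ball_nonempty hlsc hne hconv
    (show (0 : ℝ) < 1 / 2 ^ 0 by positivity)
  let G (n : ℕ) : {g : C(X, E) // ∀ x, (Φ x ∩ ball (g x) (1 / 2 ^ n)).Nonempty} :=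
    Nat.rec ⟨g₀, hg₀⟩ next n
  have hG (x : X) (n : ℕ) : dist ((G n).1 x) ((G (n + 1)).1 x) ≤ 4 / 2 / 2 ^ n := hnext n (G n) x
  have hlim (x : X) : ∃ a, Tendsto (fun n => (G n).1 x) atTop (𝓝 a) :=
    cauchySeq_tendsto_of_complete (cauchySeq_of_le_geometric_two (hG x))
  choose a ha using hlim
  have hdist (x : X) (n : ℕ) : dist ((G n).1 x) (a x) ≤ 4 / 2 ^ n :=
    dist_le_of_le_geometric_two_of_tendsto (hG x) (ha x) n
  have hpow (c ε : ℝ) (hε : 0 < ε) : ∀ᶠ n : ℕ in atTop, c / 2 ^ n < ε := by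
    have : Tendsto (fun n : ℕ => c / (2 : ℝ) ^ n) atTop (𝓝 0) :=
      tendsto_const_nhds.div_atTop (tendsto_pow_atTop_atTop_of_one_lt one_lt_two)
    exact this.eventually_lt_const hε
  have hunif : TendstoUniformly (fun n x => (G n).1 x) a atTop := by
    rw [Metric.tendstoUniformly_iff]
    intro ε hε
    filter_upwards [hpow 4 ε hε] with n hn x
    rw [dist_comm]
    exact (hdist x n).trans_lt hn
  refine ⟨⟨a, hunif.continuous (Frequently.of_forall fun n => (G n).1.continuous)⟩, fun x => ?_⟩
  refine Metric.mem_closure_iff.2 fun ε hε => ?_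
  obtain ⟨n, hn⟩ := (hpow 5 ε hε).exists
  obtain ⟨z, hz, hzb⟩ := (G n).2 x
  refine ⟨z, hz, ?_⟩
  have h1 := dist_triangle_left (a x) z ((G n).1 x)
  have h2 := hdist x n
  have h3 : (5 : ℝ) / 2 ^ n = 4 / 2 ^ n + 1 / 2 ^ n := by ring
  rw [mem_ball'] at hzb
  change dist (a x) z < ε
  linarith

variable [FiniteDimensional ℝ E]

/-- Countably many continuous selections of the closures which are pointwise dense. -/
theorem exists_seq_continuousMap_mem_closure {Φ : X → Set E}
    (hlsc : ∀ x, LscAt Φ x) (hne : ∀ x, (Φ x).Nonempty) (hconv : ∀ x, Convex ℝ (Φ x)) :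
    ∃ g : ℕ → C(X, E), (∀ n x, g n x ∈ closure (Φ x)) ∧
      ∀ x, Φ x ⊆ closure (range fun n => g n x) := by
  classical
  have : ProperSpace E := FiniteDimensional.proper ℝ E
  let B (i k : ℕ) : Set E := ball (TopologicalSpace.denseSeq E i) (1 / (k + 1))
  have hU (i k : ℕ) : IsOpen {x | (Φ x ∩ B i k).Nonempty} :=
    isOpen_iff_mem_nhds.2 fun x hx => hlsc x _ isOpen_ball hx
  choose F hFc hFs hFU hFm using fun i k => (hU i k).exists_iUnion_isClosed
  have hsel (p : ℕ × ℕ × ℕ) : ∃ g : C(X, E), (∀ x, g x ∈ closure (Φ x)) ∧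
      ∀ x ∈ F p.1 p.2.1 p.2.2, g x ∈ closure (B p.1 p.2.1) := by
    obtain ⟨i, k, m⟩ := p
    obtain ⟨g, hg⟩ := exists_continuousMap_mem_closure
      (Φ := fun x => if x ∈ F i k m then Φ x ∩ B i k else Φ x)
      (fun x => (hlsc x).ite_inter (hFc i k m) isOpen_ball)
      (fun x => by
        split_ifs with hx
        · have : x ∈ ⋃ m, F i k m := mem_iUnion.2 ⟨m, hx⟩
          rwa [hFU] at this
        · exact hne x)
      (fun x => by
        split_ifs
        · exact (hconv x).inter (convex_ball _ _)
        · exact hconv x)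
    refine ⟨g, fun x => closure_mono ?_ (hg x), fun x hx => ?_⟩
    · split_ifs
      · exact inter_subset_left
      · exact Subset.rfl
    · have := hg x
      rw [if_pos hx] at this
      exact closure_mono inter_subset_right this
  choose g hg hgB using hsel
  refine ⟨fun n => g ((Denumerable.eqv (ℕ × ℕ × ℕ)).symm n), fun n => hg _, fun x y hy => ?_⟩
  refine Metric.mem_closure_iff.2 fun ε hε => ?_
  obtain ⟨k, hk⟩ := exists_nat_one_div_lt (half_pos hε)
  obtain ⟨i, hi⟩ := (TopologicalSpace.denseRange_denseSeq E).exists_dist_lt y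
    (show (0 : ℝ) < 1 / (k + 1) by positivity)
  have hx : x ∈ ⋃ m, F i k m := by
    rw [hFU]
    exact ⟨y, hy, hi⟩
  obtain ⟨m, hm⟩ := mem_iUnion.1 hx
  refine ⟨_, ⟨Denumerable.eqv _ (i, k, m), rfl⟩, ?_⟩
  have h1 := mem_closedBall.1 (closure_ball_subset_closedBall (hgB (i, k, m) x hm))
  have h2 := dist_triangle_right y (g (i, k, m) x) (TopologicalSpace.denseSeq E i)
  simp only [Equiv.symm_apply_apply] at h1 ⊢
  linarith


end Selection

section Convex

variable {E : Type*} [NormedAddCommGroup E] [NormedSpace ℝ E] [FiniteDimensional ℝ E]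

theorem Convex.zero_mem_of_hasSum_of_span_eq_top {K : Set E} (hK : Convex ℝ K)
    (hspan : Submodule.span ℝ K = ⊤) {y : ℕ → E} (hy : ∀ n, y n ∈ closure K)
    (hdense : K ⊆ closure (range y)) {w : ℕ → ℝ} (hw : ∀ n, 0 < w n) (hw1 : HasSum w 1)
    (hz : HasSum (fun n => w n • y n) 0) : (0 : E) ∈ K := by
  by_contra h0
  by_cases hint : (interior K).Nonempty
  · obtain ⟨f, hf⟩ := geometric_hahn_banach_open_point hK.interior isOpen_interior
      (fun h => h0 (interior_subset h))
    rw [map_zero] at hf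
    have hfy (n : ℕ) : f (y n) ≤ 0 := by
      have h1 := hy n
      rw [← hK.closure_interior_eq_closure_of_nonempty_interior hint] at h1
      exact closure_minimal (fun a ha => (hf a ha).le)
        (isClosed_le f.continuous continuous_const) h1
    have hs : HasSum (fun n => -(w n * f (y n))) 0 := by
      simpa using (f.hasSum hz).neg
    have hs0 := (hasSum_zero_iff_of_nonneg fun n =>
      neg_nonneg.2 (mul_nonpos_of_nonneg_of_nonpos (hw n).le (hfy n))).1 hs
    obtain ⟨a, ha⟩ := hint
    obtain ⟨_, hb, n, rfl⟩ := mem_closure_iff.1 (hdense (interior_subset ha)) {b | f b < 0}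
      (isOpen_lt f.continuous continuous_const) (hf a ha)
    have := congrFun hs0 n
    simp only [Pi.zero_apply, neg_eq_zero, mul_eq_zero, (hw n).ne', false_or] at this
    exact hb.ne this
  · have hne : K.Nonempty := closure_nonempty_iff.1 ⟨_, hy 0⟩
    have hv : vectorSpan ℝ K ≠ ⊤ := fun h => hint <|
      hK.interior_nonempty_iff_affineSpan_eq_top.2 <|
        (AffineSubspace.affineSpan_eq_top_iff_vectorSpan_eq_top_of_nonempty ℝ E E hne).2 h
    obtain ⟨f, hf0, hf⟩ := Submodule.exists_le_ker_of_lt_top _ hv.lt_top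
    obtain ⟨k, hk⟩ := hne
    have hfK : ∀ a ∈ K, f a = f k := fun a ha => by
      have : f (a -ᵥ k) = 0 := hf (vsub_mem_vectorSpan ℝ ha hk)
      rwa [vsub_eq_sub, map_sub, sub_eq_zero] at this
    have hfc : Continuous f := f.continuous_of_finiteDimensional
    have hfy (n : ℕ) : f (y n) = f k :=
      closure_minimal hfK (isClosed_eq hfc continuous_const) (hy n)
    have hs : HasSum (fun n => w n * f (y n)) 0 := by
      simpa using f.toContinuousLinearMap.hasSum hz
    simp only [hfy] at hs
    have hk0 : f k = 0 := by simpa using (hw1.mul_right (f k)).unique hs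
    refine hf0 (LinearMap.ker_eq_top.1 (top_le_iff.1 ?_))
    rw [← hspan, Submodule.span_le]
    exact fun a ha => (hfK a ha).trans hk0

/-- A convex combination with positive weights of a sequence which is dense in a
finite-dimensional convex set belongs to this set, even if the set is not closed. -/
theorem Convex.mem_of_hasSum_of_subset_closure_range {K : Set E} (hK : Convex ℝ K)
    {y : ℕ → E} (hy : ∀ n, y n ∈ closure K) (hdense : K ⊆ closure (range y)) {w : ℕ → ℝ}
    (hw : ∀ n, 0 < w n) (hw1 : HasSum w 1) {z : E} (hz : HasSum (fun n => w n • y n) z) :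
    z ∈ K := by
  set V := Submodule.span ℝ ((fun a => a - z) '' K)
  have hVc : IsClosed (V : Set E) := V.closed_of_finiteDimensional
  have hKV (a : E) (ha : a ∈ K) : a - z ∈ V := Submodule.subset_span ⟨a, ha, rfl⟩
  have hyV (n : ℕ) : y n - z ∈ V :=
    closure_minimal hKV (hVc.preimage (continuous_id.sub continuous_const)) (hy n)
  set K' : Set V := {v | (v : E) + z ∈ K}
  have hK' : Convex ℝ K' := (hK.translate_preimage_left z).linear_preimage V.subtype
  suffices h : (0 : V) ∈ K' by simpa [K'] using h
  refine hK'.zero_mem_of_hasSum_of_span_eq_top (y := fun n => ⟨y n - z, hyV n⟩) (w := w)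
    ?_ (fun n => ?_) (fun v hv => ?_) hw hw1 ?_
  · refine Submodule.map_injective_of_injective V.injective_subtype ?_
    rw [Submodule.map_span, Submodule.map_top, Submodule.range_subtype]
    congr 1
    ext a
    constructor
    · rintro ⟨v, hv, rfl⟩
      exact ⟨_, hv, by simp⟩
    · rintro ⟨b, hb, rfl⟩
      exact ⟨⟨_, hKV b hb⟩, by simpa [K'] using hb, rfl⟩
  · refine Metric.mem_closure_iff.2 fun ε hε => ?_
    obtain ⟨b, hb, hd⟩ := Metric.mem_closure_iff.1 (hy n) ε hε
    exact ⟨⟨_, hKV b hb⟩, by simpa [K'] using hb, by simpa [Subtype.dist_eq] using hd⟩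
  · refine Metric.mem_closure_iff.2 fun ε hε => ?_
    obtain ⟨_, ⟨n, rfl⟩, hd⟩ := Metric.mem_closure_iff.1 (hdense hv) ε hε
    refine ⟨_, ⟨n, rfl⟩, ?_⟩
    rw [Subtype.dist_eq, dist_eq_norm] at *
    convert hd using 2
    simp only
    abel
  · have h : HasSum (fun n => w n • (y n - z)) 0 := by
      simpa [smul_sub] using hz.sub (hw1.smul_const z)
    exact Topology.IsInducing.subtypeVal.hasSum_iff (g := V.subtype) _ _ |>.1 h

end Convex

/-- A bounded lower semicontinuous map with nonempty convex values in a finite-dimensional space has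
a continuous selection. -/
theorem exists_continuousMap_mem {X E : Type*} [MetricSpace X] [NormedAddCommGroup E]
    [NormedSpace ℝ E] [FiniteDimensional ℝ E] {Φ : X → Set E}
    (hlsc : ∀ x, LscAt Φ x) (hne : ∀ x, (Φ x).Nonempty) (hconv : ∀ x, Convex ℝ (Φ x))
    {C : Set E} (hC : IsCompact C) (hΦC : ∀ x, Φ x ⊆ C) : ∃ g : C(X, E), ∀ x, g x ∈ Φ x := by
  obtain ⟨g, hg, hdense⟩ := exists_seq_continuousMap_mem_closure hlsc hne hconv
  obtain ⟨R, hR⟩ := hC.isBounded.exists_norm_le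
  have hgR (n : ℕ) (x : X) : ‖g n x‖ ≤ R := hR _ (closure_minimal (hΦC x) hC.isClosed (hg n x))
  have hw1 : HasSum (fun n : ℕ => (1 : ℝ) / 2 / 2 ^ n) 1 := hasSum_geometric_two' 1
  have hbd (n : ℕ) (x : X) : ‖((1 : ℝ) / 2 / 2 ^ n) • g n x‖ ≤ 1 / 2 / 2 ^ n * R := by
    rw [norm_smul, Real.norm_of_nonneg (by positivity)]
    gcongr
    exact hgR n x
  refine ⟨⟨fun x => ∑' n : ℕ, ((1 : ℝ) / 2 / 2 ^ n) • g n x,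
    continuous_tsum (fun n => by fun_prop) (hw1.summable.mul_right R) hbd⟩, fun x => ?_⟩
  exact (hconv x).mem_of_hasSum_of_subset_closure_range (fun n => hg n x) (hdense x)
    (fun n => by positivity) hw1
    (Summable.of_norm_bounded (hw1.summable.mul_right R) fun n => hbd n x).hasSum

/-- Every lower semicontinuous set-valued map from a nonempty convex compact subset
`C ⊆ ℝⁿ` to `C` itself with nonempty convex values has a fixed point. -/
theorem fixed_point_of_lsc {n : ℕ} {C : Set (Fin n → ℝ)}
    (hCne : C.Nonempty) (hCconv : Convex ℝ C) (hCcomp : IsCompact C)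
    (Φ : C → Set C)
    (hΦlsc : ∀ x : C, LscAt Φ x)
    (hΦne : ∀ x : C, (Φ x).Nonempty)
    (hΦconv : ∀ x : C, Convex ℝ (Subtype.val '' Φ x)) :
    ∃ x : C, x ∈ Φ x := by
  classical
  let Ψ (x : Fin n → ℝ) : Set (Fin n → ℝ) := if h : x ∈ C then Subtype.val '' Φ ⟨x, h⟩ else C
  have hΨ (x : Fin n → ℝ) (h : x ∈ C) : Ψ x = Subtype.val '' Φ ⟨x, h⟩ := dif_pos h
  have hΨ' (x : Fin n → ℝ) (h : x ∉ C) : Ψ x = C := dif_neg h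
  have hΨC (x : Fin n → ℝ) : Ψ x ⊆ C := by
    by_cases h : x ∈ C
    · rw [hΨ x h]
      exact Subtype.coe_image_subset _ _
    · rw [hΨ' x h]
  have hlsc (x : Fin n → ℝ) : LscAt Ψ x := by
    intro Ω hΩ hne
    have hCΩ : (C ∩ Ω).Nonempty := hne.mono (inter_subset_inter_left _ (hΨC x))
    by_cases h : x ∈ C
    · rw [hΨ x h] at hne
      obtain ⟨_, ⟨y, hy, rfl⟩, hyΩ⟩ := hne
      have hev := hΦlsc ⟨x, h⟩ (Subtype.val ⁻¹' Ω) (hΩ.preimage continuous_subtype_val)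
        ⟨y, hy, hyΩ⟩
      rw [nhds_subtype_eq_comap, eventually_comap] at hev
      filter_upwards [hev] with x' hx'
      by_cases h' : x' ∈ C
      · rw [hΨ x' h']
        obtain ⟨z, hz, hzΩ⟩ := hx' ⟨x', h'⟩ rfl
        exact ⟨z, ⟨z, hz, rfl⟩, hzΩ⟩
      · rwa [hΨ' x' h']
    · filter_upwards [hCcomp.isClosed.isOpen_compl.mem_nhds h] with x' hx'
      rwa [hΨ' x' hx']
  have hne (x : Fin n → ℝ) : (Ψ x).Nonempty := by
    by_cases h : x ∈ C
    · rw [hΨ x h]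
      exact (hΦne _).image _
    · rwa [hΨ' x h]
  have hconv (x : Fin n → ℝ) : Convex ℝ (Ψ x) := by
    by_cases h : x ∈ C
    · rw [hΨ x h]
      exact hΦconv _
    · rwa [hΨ' x h]
  obtain ⟨g, hg⟩ := exists_continuousMap_mem hlsc hne hconv hCcomp hΨC
  obtain ⟨x, hx⟩ := exists_fixedPoint_of_isBounded_range g.continuous
    (hCcomp.isBounded.subset (range_subset_iff.2 fun x => hΨC x (hg x)))
  have hxC : x ∈ C := by
    rw [← hx]
    exact hΨC x (hg x)
  have hxΨ := hg x
  rw [hx, hΨ x hxC] at hxΨ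
  obtain ⟨y, hy, rfl⟩ := hxΨ
  exact ⟨y, hy⟩
end

section
/- Let C ⊆ ℝ^n be a nonempty convex compact set and f : C × C → ℝ a bifunction with f(x,x) = 0 for all x ∈ C. Define F : C ⇉ C by F(x) := {y ∈ C : f(x,y) < 0}. If F is lower semicontinuous and F(x) is convex for every x ∈ C, then there exists x ∈ C such that f(x,y) ≥ 0 for all y ∈ C. -/
open Set Topology Filter

theorem exists_clm_nonneg_of_zero_notMem {V : Type*} [NormedAddCommGroup V] [NormedSpace ℝ V]
    [FiniteDimensional ℝ V] {K : Set V} (hK : Convex ℝ K) (hne : K.Nonempty) (h0 : (0 : V) ∉ K) :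
    ∃ p : V →L[ℝ] ℝ, (∀ y ∈ K, 0 ≤ p y) ∧ ∃ y ∈ K, 0 < p y := by
  by_cases hA : (0 : V) ∈ affineSpan ℝ K
  · set W := Submodule.span ℝ K with hW
    set S : Set W := W.subtype ⁻¹' K with hS
    have hSK : W.subtype '' S = K := by
      rw [hS, image_preimage_eq_inter_range]
      rw [inter_eq_left]
      exact fun x hx => ⟨⟨x, Submodule.subset_span hx⟩, rfl⟩
    have hSc : Convex ℝ S := hK.linear_preimage W.subtype
    have hmap : (affineSpan ℝ S).map W.subtype.toAffineMap = affineSpan ℝ K := by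
      rw [AffineSubspace.map_span]
      congr 1
    have h0S : (0 : W) ∈ affineSpan ℝ S := by
      rw [← hmap] at hA
      obtain ⟨w, hw, hw0⟩ := hA
      have : w = 0 := by simpa using hw0
      exact this ▸ hw
    have htop : affineSpan ℝ S = ⊤ := by
      have h1 : affineSpan ℝ (insert (0 : W) S) = affineSpan ℝ S := affineSpan_insert_eq_affineSpan ℝ h0S
      rw [← h1]
      apply SetLike.coe_injective
      rw [affineSpan_insert_zero]
      have : Submodule.span ℝ S = ⊤ := by
        apply Submodule.map_injective_of_injective W.injective_subtype
        rw [Submodule.map_span, hSK, Submodule.map_subtype_top]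
      rw [this]; simp
    have hint : (interior S).Nonempty := hSc.interior_nonempty_iff_affineSpan_eq_top.2 htop
    obtain ⟨f, hf⟩ := geometric_hahn_banach_open_point hSc.interior isOpen_interior
      (x := (0 : W)) (fun h => h0 (by simpa [hS] using interior_subset h))
    obtain ⟨g, hg⟩ := LinearMap.exists_extend (-f : W →L[ℝ] ℝ).toLinearMap
    have hgf : ∀ w : W, g w = - f w := fun w => by
      have := LinearMap.congr_fun hg w
      simpa using this
    refine ⟨LinearMap.toContinuousLinearMap g, ?_, ?_⟩
    · intro y hy
      obtain ⟨w, hw, rfl⟩ := hSK.symm ▸ hy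
      have hcl : w ∈ closure (interior S) := by
        rw [hSc.closure_interior_eq_closure_of_nonempty_interior hint]
        exact subset_closure hw
      have : f w ≤ 0 := by
        refine closure_minimal (t := {w | f w ≤ 0}) ?_ (isClosed_le f.continuous continuous_const) hcl
        intro v hv
        simpa using (hf v hv).le
      have h2 := hgf w
      simp at h2 ⊢
      linarith
    · obtain ⟨w, hw⟩ := hint
      refine ⟨w, (interior_subset hw : w ∈ S), ?_⟩
      have h2 := hgf w
      have := hf w hw
      simp at this h2 ⊢
      linarith
  · obtain ⟨f, u, h1, h2⟩ := geometric_hahn_banach_point_closed (affineSpan ℝ K).convex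
      (AffineSubspace.closed_of_finiteDimensional _) hA
    rw [map_zero] at h1
    have h3 : ∀ y ∈ K, 0 < f y := fun y hy => h1.trans (h2 y (subset_affineSpan ℝ K hy))
    exact ⟨f, fun y hy => (h3 y hy).le, hne.imp fun y hy => ⟨hy, h3 y hy⟩⟩

theorem Convex.mem_of_hasSum_of_dense {V : Type*} [NormedAddCommGroup V] [NormedSpace ℝ V]
    [FiniteDimensional ℝ V] {K : Set V} (hK : Convex ℝ K) (hne : K.Nonempty)
    {ι : Type*} {w : ι → ℝ} {y : ι → V} {z : V}
    (hw : ∀ i, 0 < w i) (hw1 : HasSum w 1) (hz : HasSum (fun i => w i • y i) z)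
    (hy : ∀ i, y i ∈ closure K) (hd : K ⊆ closure (range y)) : z ∈ K := by
  by_contra hzK
  obtain ⟨p, hp, x, hx, hpx⟩ := exists_clm_nonneg_of_zero_notMem (hK.translate (-z)) (hne.image _)
    (by simpa [neg_add_eq_zero] using fun h => hzK h)
  have hp' : ∀ v ∈ K, p z ≤ p v := fun v hv => by
    have := hp _ (mem_image_of_mem _ hv)
    simp at this; linarith
  have hpc : ∀ v ∈ closure K, p z ≤ p v := fun v hv =>
    closure_minimal (t := {v | p z ≤ p v}) hp' (isClosed_le continuous_const p.continuous) hv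
  have hs : HasSum (fun i => w i * (p (y i) - p z)) 0 := by
    have h1 : HasSum (fun i => w i * p (y i)) (p z) := by simpa using hz.mapL p
    simpa [mul_sub] using h1.sub (hw1.mul_right (p z))
  have h0 : ∀ i, p (y i) = p z := by
    have := (hasSum_zero_iff_of_nonneg
      (fun i => mul_nonneg (hw i).le (sub_nonneg.2 (hpc _ (hy i))))).1 hs
    intro i
    have := congr_fun this i
    simp [(hw i).ne'] at this
    linarith
  obtain ⟨v, hv, rfl⟩ := hx
  have : p v = p z :=
    closure_minimal (t := {v | p v = p z}) (by rintro _ ⟨i, rfl⟩; exact h0 i)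
      (isClosed_eq p.continuous continuous_const) (hd hv)
  simp [this] at hpx

theorem LscAt.inter_of_isOpen {X Y : Type*} [TopologicalSpace X] [TopologicalSpace Y]
    {Φ : X → Set Y} {x : X} (h : LscAt Φ x) {O : Set (X × Y)} (hO : IsOpen O) :
    LscAt (fun x => Φ x ∩ {y | (x, y) ∈ O}) x := by
  rintro Ω hΩ ⟨y, ⟨hy, hyO⟩, hyΩ⟩
  obtain ⟨U, W, hU, hW, hxU, hyW, hUW⟩ := isOpen_prod_iff.1 hO x y hyO
  filter_upwards [h (W ∩ Ω) (hW.inter hΩ) ⟨y, hy, hyW, hyΩ⟩, hU.mem_nhds hxU]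
  rintro x' ⟨y', h1, h2, h3⟩ hx'
  exact ⟨y', ⟨h1, hUW ⟨hx', h2⟩⟩, h3⟩

theorem LscAt.piecewise_of_isClosed {X Y : Type*} [TopologicalSpace X] [TopologicalSpace Y]
    {Φ Ψ : X → Set Y} (hΦ : ∀ x, LscAt Φ x) (hΨ : ∀ x, LscAt Ψ x) {A : Set X} (hA : IsClosed A)
    (h : ∀ x, Ψ x ⊆ Φ x) [DecidablePred (· ∈ A)] (x : X) : LscAt (A.piecewise Ψ Φ) x := by
  intro Ω hΩ hne
  by_cases hx : x ∈ A
  · rw [piecewise_eq_of_mem _ _ _ hx] at hne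
    filter_upwards [hΨ x Ω hΩ hne] with x' hx'
    by_cases hx'A : x' ∈ A
    · rwa [piecewise_eq_of_mem _ _ _ hx'A]
    · rw [piecewise_eq_of_notMem _ _ _ hx'A]
      exact hx'.mono (inter_subset_inter_left _ (h x'))
  · rw [piecewise_eq_of_notMem _ _ _ hx] at hne
    filter_upwards [hΦ x Ω hΩ hne, hA.isOpen_compl.mem_nhds hx] with x' hx' hx'A
    rwa [piecewise_eq_of_notMem _ _ _ hx'A]

section Selection

variable {X V : Type*} [TopologicalSpace X] [NormalSpace X] [ParacompactSpace X]
  [NormedAddCommGroup V] [NormedSpace ℝ V]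

theorem exists_continuous_approx_selection {Φ : X → Set V} (hlsc : ∀ x, LscAt Φ x)
    (hconv : ∀ x, Convex ℝ (Φ x)) (hne : ∀ x, (Φ x).Nonempty) {ε : ℝ} (hε : 0 < ε) :
    ∃ g : C(X, V), ∀ x, (Φ x ∩ Metric.ball (g x) ε).Nonempty := by
  obtain ⟨g, hg⟩ := exists_continuous_forall_mem_convex_of_local_const
    (t := fun x => Metric.thickening ε (Φ x)) (fun x => (hconv x).thickening ε) (fun x => by
      obtain ⟨y, hy⟩ := hne x
      refine ⟨y, ?_⟩
      filter_upwards [hlsc x _ Metric.isOpen_ball ⟨y, hy, Metric.mem_ball_self hε⟩]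
      rintro x' ⟨z, hz, hzy⟩
      exact Metric.mem_thickening_iff.2 ⟨z, hz, by rwa [dist_comm]⟩)
  refine ⟨g, fun x => ?_⟩
  obtain ⟨z, hz, hzg⟩ := Metric.mem_thickening_iff.1 (hg x)
  exact ⟨z, hz, by rwa [Metric.mem_ball, dist_comm]⟩

/-- **Michael's selection theorem**, for the closures of the values. -/
theorem exists_continuous_selection_closure [CompleteSpace V] {Φ : X → Set V}
    (hlsc : ∀ x, LscAt Φ x) (hconv : ∀ x, Convex ℝ (Φ x)) (hne : ∀ x, (Φ x).Nonempty) :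
    ∃ g : C(X, V), ∀ x, g x ∈ closure (Φ x) := by
  let T := {Ψ : X → Set V // (∀ x, LscAt Ψ x) ∧ (∀ x, Convex ℝ (Ψ x)) ∧ (∀ x, (Ψ x).Nonempty) ∧
    ∀ x, Ψ x ⊆ Φ x}
  have hε : ∀ k : ℕ, (0 : ℝ) < 1 / 2 ^ k := fun k => by positivity
  choose sel hsel using fun (Ψ : T) (k : ℕ) =>
    exists_continuous_approx_selection Ψ.2.1 Ψ.2.2.1 Ψ.2.2.2.1 (hε k)
  let next : ℕ → T → T := fun k Ψ => ⟨fun x => Ψ.1 x ∩ Metric.ball (sel Ψ k x) (1 / 2 ^ k), by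
    refine ⟨fun x => ?_, fun x => (Ψ.2.2.1 x).inter (convex_ball _ _), hsel Ψ k,
      fun x => inter_subset_left.trans (Ψ.2.2.2.2 x)⟩
    exact (Ψ.2.1 x).inter_of_isOpen (O := {p | dist p.2 (sel Ψ k p.1) < 1 / 2 ^ k})
      (isOpen_lt (by fun_prop) (by fun_prop))⟩
  let Ψ : ℕ → T := fun k => Nat.rec ⟨Φ, hlsc, hconv, hne, fun x => Subset.rfl⟩ next k
  let g : ℕ → X → V := fun k => sel (Ψ k) k
  have hdist : ∀ x k, dist (g k x) (g (k + 1) x) ≤ 4 / 2 / 2 ^ k := fun x k => by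
    obtain ⟨y, hy, hy2⟩ := hsel (Ψ (k + 1)) (k + 1) x
    have hy1 : dist y (g k x) < 1 / 2 ^ k := hy.2
    have hy2 : dist y (g (k + 1) x) < 1 / 2 ^ (k + 1) := hy2
    have h3 : (1 : ℝ) / 2 ^ (k + 1) ≤ 1 / 2 ^ k := by
      gcongr <;> norm_num
    have h4 : (4 : ℝ) / 2 / 2 ^ k = 1 / 2 ^ k + 1 / 2 ^ k := by ring
    linarith [dist_triangle_left (g k x) (g (k + 1) x) y]
  choose G hG using fun x => cauchySeq_tendsto_of_complete (cauchySeq_of_le_geometric_two (hdist x))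
  have hGd : ∀ x k, dist (g k x) (G x) ≤ 4 / 2 ^ k := fun x k =>
    dist_le_of_le_geometric_two_of_tendsto (hdist x) (hG x) k
  have hlim : ∀ c : ℝ, Tendsto (fun k : ℕ => c / 2 ^ k) atTop (𝓝 0) := fun c => by
    simpa [div_eq_mul_inv] using
      (tendsto_pow_atTop_nhds_zero_of_lt_one (r := (2 : ℝ)⁻¹) (by norm_num) (by norm_num)).const_mul c
  have hunif : TendstoUniformly g G atTop := by
    rw [Metric.tendstoUniformly_iff]
    intro ε hε
    filter_upwards [(hlim 4).eventually_lt_const hε] with k hk x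
    rw [dist_comm]
    exact (hGd x k).trans_lt hk
  refine ⟨⟨G, hunif.continuous (Frequently.of_forall fun k => (sel (Ψ k) k).continuous)⟩,
    fun x => ?_⟩
  rw [Metric.mem_closure_iff]
  intro ε hε
  obtain ⟨k, hk⟩ := ((hlim 5).eventually_lt_const hε).exists
  obtain ⟨y, hy, hy2⟩ := hsel (Ψ k) k x
  have hy2 : dist y (g k x) < 1 / 2 ^ k := hy2
  refine ⟨y, (Ψ k).2.2.2.2 x hy, ?_⟩
  have h5 : (5 : ℝ) / 2 ^ k = 4 / 2 ^ k + 1 / 2 ^ k := by ring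
  have := hGd x k
  calc dist (G x) y ≤ dist (G x) (g k x) + dist y (g k x) := dist_triangle_right _ _ _
    _ < ε := by rw [dist_comm (G x)]; linarith

end Selection

/-- **Michael's selection theorem** for convex, not necessarily closed, values contained in a fixed
ball of a finite-dimensional space. -/
theorem exists_continuous_selection {X V : Type*} [PseudoEMetricSpace X]
    [NormedAddCommGroup V] [NormedSpace ℝ V] [FiniteDimensional ℝ V] {Φ : X → Set V}
    (hlsc : ∀ x, LscAt Φ x) (hconv : ∀ x, Convex ℝ (Φ x)) (hne : ∀ x, (Φ x).Nonempty)
    {R : ℝ} (hR : ∀ x, Φ x ⊆ Metric.closedBall 0 R) :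
    ∃ g : X → V, Continuous g ∧ ∀ x, g x ∈ Φ x := by
  classical
  have : CompleteSpace V := FiniteDimensional.complete ℝ V
  have : ProperSpace V := FiniteDimensional.proper ℝ V
  let B : ℕ × ℕ → Set V := fun i => Metric.ball (TopologicalSpace.denseSeq V i.1) (1 / (i.2 + 1))
  have hUo : ∀ i, IsOpen {x | (Φ x ∩ B i).Nonempty} := fun i => by
    rw [isOpen_iff_mem_nhds]
    exact fun x hx => hlsc x _ Metric.isOpen_ball hx
  choose A hA hAx hAU using fun i => (hUo i).exists_iUnion_isClosed
  have key : ∀ i : (ℕ × ℕ) × ℕ, ∃ g : C(X, V), ∀ x, g x ∈ closure (Φ x) ∧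
      (x ∈ A i.1 i.2 → g x ∈ closure (B i.1)) := fun i => by
    obtain ⟨g, hg⟩ := exists_continuous_selection_closure
      (Φ := (A i.1 i.2).piecewise (fun x => Φ x ∩ B i.1) Φ)
      (LscAt.piecewise_of_isClosed hlsc (fun x => (hlsc x).inter_of_isOpen
        (O := Prod.snd ⁻¹' B i.1) (Metric.isOpen_ball.preimage continuous_snd)) (hA i.1 i.2)
        fun x => inter_subset_left)
      (fun x => by
        by_cases hx : x ∈ A i.1 i.2
        · simpa [hx] using (hconv x).inter (convex_ball _ _)
        · simpa [hx] using hconv x)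
      (fun x => by
        by_cases hx : x ∈ A i.1 i.2
        · simpa [hx] using hAx i.1 i.2 hx
        · simpa [hx] using hne x)
    refine ⟨g, fun x => ?_⟩
    have := hg x
    by_cases hx : x ∈ A i.1 i.2
    · rw [piecewise_eq_of_mem _ _ _ hx] at this
      exact ⟨closure_mono inter_subset_left this, fun _ => closure_mono inter_subset_right this⟩
    · rw [piecewise_eq_of_notMem _ _ _ hx] at this
      exact ⟨this, fun h => absurd h hx⟩
  choose G hG hGB using key
  let e : ℕ ≃ (ℕ × ℕ) × ℕ := (Denumerable.eqv _).symm
  let w : ℕ → ℝ := fun k => 1 / 2 / 2 ^ k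
  have hw : ∀ k, 0 < w k := fun k => by positivity
  have hw1 : HasSum w 1 := hasSum_geometric_two' 1
  have hb : ∀ k x, ‖w k • G (e k) x‖ ≤ w k * R := fun k x => by
    rw [norm_smul, Real.norm_of_nonneg (hw k).le]
    refine mul_le_mul_of_nonneg_left ?_ (hw k).le
    simpa using closure_minimal (hR x) Metric.isClosed_closedBall (hG (e k) x)
  have hsum : Summable fun k => w k * R := hw1.summable.mul_right R
  refine ⟨fun x => ∑' k, w k • G (e k) x, continuous_tsum (fun k => by fun_prop) hsum hb,
    fun x => ?_⟩
  refine (hconv x).mem_of_hasSum_of_dense (hne x) hw hw1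
    (Summable.of_norm_bounded hsum fun k => hb k x).hasSum (fun k => hG _ x) fun y hy => ?_
  rw [Metric.mem_closure_iff]
  intro ε hε
  obtain ⟨m, hm⟩ := exists_nat_one_div_lt (half_pos hε)
  obtain ⟨j, hj⟩ := (TopologicalSpace.denseRange_denseSeq V).exists_dist_lt y
    (Nat.one_div_pos_of_nat (α := ℝ) (n := m))
  have hxU : x ∈ ⋃ l, A (j, m) l := by
    rw [(hAU _).1]
    exact ⟨y, hy, hj⟩
  obtain ⟨l, hl⟩ := mem_iUnion.1 hxU
  refine ⟨_, ⟨e.symm ((j, m), l), rfl⟩, ?_⟩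
  have := Metric.closure_ball_subset_closedBall (hGB ((j, m), l) x hl)
  beta_reduce
  rw [Equiv.apply_symm_apply]
  rw [Metric.mem_closedBall] at this
  have h6 := dist_triangle_right y (G ((j, m), l) x) (TopologicalSpace.denseSeq V j)
  simp only at this
  linarith

theorem exists_polynomial_eval_eq_det {E : Type*} [NormedAddCommGroup E] [NormedSpace ℝ E]
    [FiniteDimensional ℝ E] (A : E →L[ℝ] E) :
    ∃ P : Polynomial ℝ, P.natDegree ≤ Module.finrank ℝ E ∧
      ∀ t : ℝ, P.eval t = (1 + t • A).det := by
  let b := Module.finBasis ℝ E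
  let M := LinearMap.toMatrix b b A.toLinearMap
  refine ⟨((Polynomial.X : Polynomial ℝ) • M.map Polynomial.C +
    (1 : Matrix _ _ ℝ).map Polynomial.C).det, ?_, fun t => ?_⟩
  · simpa using Polynomial.natDegree_det_X_add_C_le M 1
  · have hM : LinearMap.toMatrix b b (1 + t • A).toLinearMap = 1 + t • M := by
      change LinearMap.toMatrix b b (LinearMap.id + t • A.toLinearMap) = _
      rw [map_add, map_smul, LinearMap.toMatrix_id]
    change _ = LinearMap.det (1 + t • A).toLinearMap
    rw [← LinearMap.det_toMatrix b, hM, ← Polynomial.coe_evalRingHom, RingHom.map_det]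
    congr 1
    ext i j
    by_cases hij : i = j <;> simp [hij, add_comm, mul_comm t]

theorem det_one_add_smul_pos {E : Type*} [NormedAddCommGroup E] [NormedSpace ℝ E]
    [FiniteDimensional ℝ E] (A : E →L[ℝ] E) {t : ℝ} (ht : 0 ≤ t) (hA : t * ‖A‖ < 1) :
    0 < (1 + t • A).det := by
  obtain ⟨P, -, hP⟩ := exists_polynomial_eval_eq_det A
  have hne : ∀ s ∈ Icc 0 t, P.eval s ≠ 0 := by
    intro s hs h0
    rw [hP] at h0
    obtain ⟨v, hv, hv0⟩ := (Submodule.ne_bot_iff _).1 (LinearMap.bot_lt_ker_of_det_eq_zero h0).ne'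
    have hv1 : v + s • A v = 0 := by simpa using hv
    have h1 : ‖v‖ = s * ‖A v‖ := by
      rw [eq_neg_of_add_eq_zero_left hv1, norm_neg, norm_smul, Real.norm_of_nonneg hs.1]
      rw [← eq_neg_of_add_eq_zero_left hv1]
    have h2 : s * ‖A v‖ ≤ t * (‖A‖ * ‖v‖) :=
      mul_le_mul hs.2 (A.le_opNorm v) (norm_nonneg _) ht
    have h3 : 0 < ‖v‖ := norm_pos_iff.2 hv0
    nlinarith
  rw [← hP]
  by_contra! hle
  have h0 : P.eval 0 = 1 := by simp [hP, ContinuousLinearMap.det]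
  obtain ⟨s, hs, h⟩ := intermediate_value_Icc' ht (P.continuous.continuousOn (s := Icc 0 t))
    (show (0 : ℝ) ∈ Icc (P.eval t) (P.eval 0) from ⟨hle, by rw [h0]; norm_num⟩)
  exact hne s hs h

theorem lipschitzWith_indicator_closedBall {E : Type*} [NormedAddCommGroup E] [NormedSpace ℝ E]
    {g : E → E} {R : ℝ} {L : NNReal} (hg : LipschitzOnWith L g (Metric.closedBall 0 R))
    (h0 : ∀ x ∈ Metric.sphere (0 : E) R, g x = 0) :
    LipschitzWith L ((Metric.closedBall 0 R).indicator g) := by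
  have key : ∀ x ∈ Metric.closedBall (0 : E) R, ∀ z ∉ Metric.closedBall (0 : E) R,
      ‖g x‖ ≤ L * dist x z := by
    intro x hx z hz
    obtain ⟨s, hs, h⟩ := intermediate_value_Icc (zero_le_one (α := ℝ))
      (f := fun s : ℝ => ‖AffineMap.lineMap (k := ℝ) x z s‖) (by fun_prop)
      (show R ∈ _ from ⟨by simpa using hx, by simpa using (not_le.1 (by simpa using hz)).le⟩)
    have hw : AffineMap.lineMap (k := ℝ) x z s ∈ Metric.sphere (0 : E) R := by simpa using h
    have h1 := hg.dist_le_mul x hx _ (Metric.sphere_subset_closedBall hw)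
    rw [h0 _ hw, dist_zero_right] at h1
    refine h1.trans (mul_le_mul_of_nonneg_left ?_ L.2)
    rw [dist_left_lineMap, Real.norm_of_nonneg hs.1]
    exact mul_le_of_le_one_left dist_nonneg hs.2
  refine LipschitzWith.of_dist_le_mul fun x y => ?_
  by_cases hx : x ∈ Metric.closedBall (0 : E) R <;> by_cases hy : y ∈ Metric.closedBall (0 : E) R
  · simpa [indicator_of_mem hx, indicator_of_mem hy] using hg.dist_le_mul x hx y hy
  · simpa [indicator_of_mem hx, indicator_of_notMem hy] using key x hx y hy
  · simpa [indicator_of_notMem hx, indicator_of_mem hy, dist_comm x y] using key y hy x hx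
  · rw [indicator_of_notMem hx, indicator_of_notMem hy, dist_self]
    positivity

theorem bijOn_closedBall_add_smul {E : Type*} [NormedAddCommGroup E] [NormedSpace ℝ E]
    [CompleteSpace E] {g : E → E} {R : ℝ} {L : NNReal}
    (hg : LipschitzOnWith L g (Metric.closedBall 0 R))
    (h0 : ∀ x ∈ Metric.sphere (0 : E) R, g x = 0) {t : ℝ} (ht : 0 ≤ t) (htL : t * L < 1)
    (hmaps : MapsTo (fun x => x + t • g x) (Metric.closedBall 0 R) (Metric.closedBall 0 R)) :
    BijOn (fun x => x + t • g x) (Metric.closedBall 0 R) (Metric.closedBall 0 R) := by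
  refine ⟨hmaps, fun x hx y hy hxy => ?_, fun y hy => ?_⟩
  · have h1 : x - y = t • (g y - g x) := by
      rw [smul_sub, sub_eq_sub_iff_add_eq_add]
      simpa [add_comm] using hxy
    have h2 : dist x y ≤ t * (L * dist x y) := by
      calc dist x y = t * dist (g x) (g y) := by
            rw [dist_eq_norm x y, h1, norm_smul, Real.norm_of_nonneg ht, dist_comm, dist_eq_norm]
        _ ≤ t * (L * dist x y) := mul_le_mul_of_nonneg_left (hg.dist_le_mul x hx y hy) ht
    by_contra hne
    have := dist_pos.2 hne
    nlinarith
  · have hG := lipschitzWith_indicator_closedBall hg h0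
    set G := (Metric.closedBall 0 R).indicator g
    lift t to NNReal using ht
    have hc : ContractingWith (t * L) fun x => y - t • G x := by
      refine ⟨by exact_mod_cast htL, LipschitzWith.of_dist_le_mul fun a b => ?_⟩
      rw [dist_sub_left, NNReal.smul_def, NNReal.smul_def, dist_smul₀, NNReal.norm_eq,
        NNReal.coe_mul, mul_assoc]
      exact mul_le_mul_of_nonneg_left (hG.dist_le_mul a b) t.2
    have hfix := hc.fixedPoint_isFixedPt
    set x := hc.fixedPoint
    have hx : x + (t : ℝ) • G x = y := by
      have : y - t • G x = x := hfix
      nth_rewrite 1 [← this]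
      simp [NNReal.smul_def]
    have hxB : x ∈ Metric.closedBall (0 : E) R := by
      by_contra hxB
      rw [show G x = 0 from indicator_of_notMem hxB g, smul_zero, add_zero] at hx
      exact hxB (hx ▸ hy)
    exact ⟨x, hxB, by simpa [G, indicator_of_mem hxB] using hx⟩

section Brouwer

open MeasureTheory Polynomial

theorem exists_sum_eval_nodes_eq_eval_one (d : ℕ) {δ : ℝ} (hδ : 0 < δ) :
    ∃ t c : ℕ → ℝ, (∀ j, 0 < t j ∧ t j < δ) ∧
      ∀ P : ℝ[X], P.natDegree ≤ d → P.eval 1 = ∑ j ∈ Finset.range (d + 1), c j * P.eval (t j) := by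
  let t : ℕ → ℝ := fun j => δ / (j + 2)
  have hinj : Function.Injective t := fun i j hij => by
    have hi : (0 : ℝ) < i + 2 := by positivity
    have hj : (0 : ℝ) < j + 2 := by positivity
    have := (div_eq_div_iff hi.ne' hj.ne').1 hij
    have := mul_left_cancel₀ hδ.ne' this
    exact_mod_cast (add_right_cancel this).symm
  refine ⟨t, fun j => (Lagrange.basis (Finset.range (d + 1)) t j).eval 1, fun j => ⟨?_, ?_⟩,
    fun P hP => ?_⟩
  · positivity
  · have : (0 : ℝ) ≤ j := j.cast_nonneg
    exact div_lt_self hδ (by linarith)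
  · conv_lhs => rw [Lagrange.eq_interpolate (hinj.injOn (s := Finset.range (d + 1))) (f := P) (by
      rw [Finset.card_range]
      exact degree_le_natDegree.trans_lt (by exact_mod_cast Nat.lt_succ_of_le hP))]
    rw [Lagrange.interpolate_apply, eval_finsetSum]
    exact Finset.sum_congr rfl fun j _ => by rw [eval_mul, eval_C, mul_comm]

/-- There is no `C¹` retraction of a ball onto its boundary sphere. -/
theorem no_contDiffOn_retraction_sphere {E : Type*} [NormedAddCommGroup E] [InnerProductSpace ℝ E]
    [FiniteDimensional ℝ E] {r : E → E} {R : ℝ} (hR : 0 < R) {U : Set E} (hU : IsOpen U)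
    (hBU : Metric.closedBall 0 R ⊆ U) (hr : ContDiffOn ℝ 1 r U)
    (hmaps : MapsTo r (Metric.closedBall 0 R) (Metric.sphere 0 R))
    (hid : ∀ x ∈ Metric.sphere (0 : E) R, r x = x) : False := by
  let _ : MeasurableSpace E := borel E
  have : BorelSpace E := ⟨rfl⟩
  have : ProperSpace E := FiniteDimensional.proper ℝ E
  let μ : Measure E := Measure.addHaar
  set B : Set E := Metric.closedBall 0 R
  have hBc : IsCompact B := isCompact_closedBall 0 R
  have hrd : ∀ x ∈ B, HasFDerivAt r (fderiv ℝ r x) x := fun x hx =>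
    ((hr.differentiableOn one_ne_zero).differentiableAt (hU.mem_nhds (hBU hx))).hasFDerivAt
  let g : E → E := fun x => r x - x
  let g' : E → E →L[ℝ] E := fun x => fderiv ℝ r x - 1
  have hgd : ∀ x ∈ B, HasFDerivAt g (g' x) x := fun x hx => (hrd x hx).sub (hasFDerivAt_id x)
  have hg'c : ContinuousOn g' B :=
    ((hr.continuousOn_fderiv_of_isOpen hU le_rfl).mono hBU).sub continuousOn_const
  obtain ⟨L, hL⟩ : ∃ L : NNReal, ∀ x ∈ B, ‖g' x‖₊ ≤ L := by
    obtain ⟨M, hM⟩ := hBc.exists_bound_of_continuousOn hg'c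
    exact ⟨M.toNNReal, fun x hx => NNReal.le_toNNReal_of_coe_le (hM x hx)⟩
  have hgL : LipschitzOnWith L g B :=
    (convex_closedBall 0 R).lipschitzOnWith_of_nnnorm_hasFDerivWithin_le
    (fun x hx => (hgd x hx).hasFDerivWithinAt) hL
  have hg0 : ∀ x ∈ Metric.sphere (0 : E) R, g x = 0 := fun x hx => sub_eq_zero.2 (hid x hx)
  obtain ⟨δ, hδ, hδ1, hδL⟩ : ∃ δ : ℝ, 0 < δ ∧ δ ≤ 1 ∧ δ * L < 1 := by
    refine ⟨1 / (L + 1), by positivity, ?_, ?_⟩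
    · rw [div_le_one (by positivity)]
      simp
    · rw [one_div_mul_eq_div, div_lt_one (by positivity)]
      simp
  have hint : ∀ t : ℝ, IntegrableOn (fun x => (1 + t • g' x).det) B μ := fun t =>
    (ContinuousLinearMap.continuous_det.comp_continuousOn
      (continuousOn_const.add (hg'c.const_smul t))).integrableOn_compact hBc
  have hV : ∀ t : ℝ, 0 < t → t < δ → ∫ x in B, (1 + t • g' x).det ∂μ = μ.real B := by
    intro t ht htδ
    have htL : t * L < 1 := lt_of_le_of_lt (mul_le_mul_of_nonneg_right htδ.le L.2) hδL
    have hbij := bijOn_closedBall_add_smul hgL hg0 ht.le htL (fun x hx => by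
      have : x + t • g x = (1 - t) • x + t • r x := by
        simp only [g, smul_sub, sub_smul, one_smul]; abel
      simp only [this]
      exact convex_closedBall 0 R hx (Metric.sphere_subset_closedBall (hmaps hx))
        (by linarith) ht.le (by ring))
    have hcv := integral_image_eq_integral_abs_det_fderiv_smul μ (f' := fun x => 1 + t • g' x)
      Metric.isClosed_closedBall.measurableSet
      (fun x hx => ((hasFDerivAt_id x).add ((hgd x hx).const_smul t)).hasFDerivWithinAt)
      hbij.injOn (fun _ => (1 : ℝ))
    rw [show (id + t • g) '' Metric.closedBall 0 R = B from hbij.image_eq] at hcv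
    simp only [smul_eq_mul, mul_one, integral_const, measureReal_restrict_apply_univ] at hcv
    rw [hcv]
    refine setIntegral_congr_fun Metric.isClosed_closedBall.measurableSet fun x hx => ?_
    refine (abs_of_pos (det_one_add_smul_pos (g' x) ht.le ?_)).symm
    exact lt_of_le_of_lt (mul_le_mul_of_nonneg_left (hL x hx) ht.le) htL
  have hdet : ∀ x ∈ Metric.ball (0 : E) R, (1 + (1 : ℝ) • g' x).det = 0 := by
    intro x hx
    have hxB := Metric.ball_subset_closedBall hx
    have h1 : (1 + (1 : ℝ) • g' x) = fderiv ℝ r x := by simp [g']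
    rw [h1]
    by_contra hne
    have hsurj : Function.Surjective (fderiv ℝ r x) := by
      have := (LinearMap.equivOfDetNeZero (fderiv ℝ r x).toLinearMap hne).surjective
      exact this
    obtain ⟨v, hv⟩ := hsurj (r x)
    have hd := (hrd x hxB).norm_sq
    have hc : HasFDerivAt (fun y => ‖r y‖ ^ 2) (0 : E →L[ℝ] ℝ) x := by
      refine (hasFDerivAt_const (R ^ 2) x).congr_of_eventuallyEq ?_
      filter_upwards [Metric.isOpen_ball.mem_nhds hx] with y hy
      have := hmaps (Metric.ball_subset_closedBall hy)
      rw [mem_sphere_zero_iff_norm.1 this]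
    have := congrArg (fun l => l v) (hd.unique hc)
    have hrx : ‖r x‖ = R := mem_sphere_zero_iff_norm.1 (hmaps hxB)
    simp [hv, hrx] at this
    exact hR.ne' this
  have hone : ∫ x in B, (1 + (1 : ℝ) • g' x).det ∂μ = 0 := by
    refine integral_eq_zero_of_ae ?_
    rw [EventuallyEq, ae_restrict_iff' Metric.isClosed_closedBall.measurableSet]
    have : ∀ᵐ x ∂μ, x ∉ Metric.sphere (0 : E) R :=
      measure_eq_zero_iff_ae_notMem.1 (Measure.addHaar_sphere_of_ne_zero μ 0 hR.ne')
    filter_upwards [this] with x hx hxB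
    refine hdet x ?_
    rw [← Metric.closedBall_sdiff_sphere]
    exact ⟨hxB, hx⟩
  obtain ⟨t, c, ht, hc⟩ := exists_sum_eval_nodes_eq_eval_one (Module.finrank ℝ E) hδ
  have hsum : ∫ x in B, (1 + (1 : ℝ) • g' x).det ∂μ = μ.real B := by
    have h1 : ∀ x, (1 + (1 : ℝ) • g' x).det =
        ∑ j ∈ Finset.range (Module.finrank ℝ E + 1), c j * (1 + t j • g' x).det := fun x => by
      obtain ⟨P, hP, hPe⟩ := exists_polynomial_eval_eq_det (g' x)
      simpa only [hPe] using hc P hP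
    have h2 : 1 = ∑ j ∈ Finset.range (Module.finrank ℝ E + 1), c j := by
      simpa using hc 1 (by simp)
    simp_rw [h1]
    rw [integral_finsetSum _ fun j _ => (hint (t j)).const_mul (c j)]
    simp_rw [integral_const_mul, hV _ (ht _).1 (ht _).2]
    rw [← Finset.sum_mul, ← h2, one_mul]
  have hpos : 0 < μ.real B := by
    refine ENNReal.toReal_pos (Metric.measure_closedBall_pos μ 0 hR).ne' hBc.measure_lt_top.ne
  linarith

/-- **Brouwer's fixed point theorem** for bounded `C¹` maps. -/
theorem exists_fixedPoint_of_contDiff_of_norm_lt {E : Type*} [NormedAddCommGroup E]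
    [InnerProductSpace ℝ E] [FiniteDimensional ℝ E] {h : E → E} (hh : ContDiff ℝ 1 h) {R : ℝ}
    (hR : ∀ x, ‖h x‖ < R) : ∃ x, h x = x := by
  by_contra! hne
  have hR0 : 0 < R := (norm_nonneg _).trans_lt (hR 0)
  let d : E → E := fun x => x - h x
  have hd : ContDiff ℝ 1 d := contDiff_id.sub hh
  have hd0 : ∀ x, d x ≠ 0 := fun x => sub_ne_zero.2 (hne x).symm
  let p : E → ℝ := fun x => inner ℝ x (d x)
  have hp : ContDiff ℝ 1 p := contDiff_id.inner ℝ hd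
  let D : E → ℝ := fun x => p x ^ 2 + ‖d x‖ ^ 2 * (R ^ 2 - ‖x‖ ^ 2)
  have hD : ContDiff ℝ 1 D :=
    (hp.pow 2).add ((hd.norm_sq ℝ).mul (contDiff_const.sub (contDiff_id.norm_sq ℝ)))
  have hps : ∀ x ∈ Metric.sphere (0 : E) R, 0 < p x := by
    intro x hx
    have hx : ‖x‖ = R := mem_sphere_zero_iff_norm.1 hx
    have h1 : p x = R ^ 2 - inner ℝ x (h x) := by
      simp only [p, d, inner_sub_right, real_inner_self_eq_norm_sq, hx]
    have h2 := real_inner_le_norm x (h x)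
    rw [hx] at h2
    nlinarith [hR x]
  have hDpos : ∀ x ∈ Metric.closedBall (0 : E) R, 0 < D x := by
    intro x hx
    have hx' : ‖x‖ ≤ R := by simpa using hx
    rcases hx'.lt_or_eq with hlt | heq
    · have h1 : 0 < ‖d x‖ ^ 2 := by have := norm_pos_iff.2 (hd0 x); positivity
      have h2 : 0 < R ^ 2 - ‖x‖ ^ 2 := by nlinarith [norm_nonneg x]
      have := mul_pos h1 h2
      have := sq_nonneg (p x)
      simp only [D]
      linarith
    · have := hps x (by simpa using heq)
      simp only [D, heq, sub_self, mul_zero, add_zero]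
      positivity
  let l : E → ℝ := fun x => (Real.sqrt (D x) - p x) / ‖d x‖ ^ 2
  have hl : ContDiffOn ℝ 1 l {x | 0 < D x} :=
    ((hD.contDiffOn.sqrt fun x hx => ne_of_gt hx).sub hp.contDiffOn).div
      (hd.norm_sq ℝ).contDiffOn fun x _ => by simpa using hd0 x
  refine no_contDiffOn_retraction_sphere (r := fun x => x + l x • d x) hR0
    (isOpen_lt continuous_const hD.continuous) hDpos
    (contDiffOn_id.add (hl.smul hd.contDiffOn)) (fun x hx => ?_) (fun x hx => ?_)
  · rw [mem_sphere_zero_iff_norm]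
    have hsq : Real.sqrt (D x) ^ 2 = D x := Real.sq_sqrt (hDpos x hx).le
    have hnd : ‖d x‖ ^ 2 ≠ 0 := by simpa using hd0 x
    have h1 : ‖x + l x • d x‖ ^ 2 = R ^ 2 := by
      rw [norm_add_sq_real, inner_smul_right, norm_smul, mul_pow, Real.norm_eq_abs, sq_abs]
      change ‖x‖ ^ 2 + 2 * (l x * p x) + l x ^ 2 * ‖d x‖ ^ 2 = R ^ 2
      have hl' : l x * ‖d x‖ ^ 2 = Real.sqrt (D x) - p x := div_mul_cancel₀ _ hnd
      have hDx : D x = p x ^ 2 + ‖d x‖ ^ 2 * (R ^ 2 - ‖x‖ ^ 2) := rfl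
      apply mul_left_cancel₀ hnd
      have e1 : ‖d x‖ ^ 2 * (‖x‖ ^ 2 + 2 * (l x * p x) + l x ^ 2 * ‖d x‖ ^ 2) =
          ‖d x‖ ^ 2 * ‖x‖ ^ 2 + 2 * (l x * ‖d x‖ ^ 2) * p x + (l x * ‖d x‖ ^ 2) ^ 2 := by ring
      rw [e1, hl']
      linear_combination hsq + hDx
    exact (pow_left_inj₀ (norm_nonneg _) hR0.le two_ne_zero).1 h1
  · have hxR : ‖x‖ = R := mem_sphere_zero_iff_norm.1 hx
    have : l x = 0 := by
      simp [l, D, hxR, Real.sqrt_sq (hps x hx).le]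
    simp [this]

/-- **Brouwer's fixed point theorem** for bounded continuous self-maps of a finite-dimensional
space. -/
theorem exists_fixedPoint_of_continuous_of_norm_le {V : Type*} [NormedAddCommGroup V]
    [NormedSpace ℝ V] [FiniteDimensional ℝ V] {s : V → V} (hs : Continuous s) {R : ℝ}
    (hR : ∀ x, ‖s x‖ ≤ R) : ∃ x, s x = x := by
  let e := toEuclidean (E := V)
  let σ := fun x => e (s (e.symm x))
  have hσ : Continuous σ := by fun_prop
  obtain ⟨M, hM⟩ : ∃ M, ∀ x, ‖σ x‖ ≤ M := by
    let T := e.toContinuousLinearMap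
    exact ⟨‖T‖ * R, fun x => (T.le_opNorm _).trans
      (mul_le_mul_of_nonneg_left (hR _) (norm_nonneg T))⟩
  suffices ∃ x, σ x = x by
    obtain ⟨x, hx⟩ := this
    exact ⟨e.symm x, e.injective (by simpa using hx)⟩
  by_contra! hne
  have hM0 : 0 ≤ M := (norm_nonneg _).trans (hM 0)
  obtain ⟨z, -, hz⟩ := (isCompact_closedBall (0 : EuclideanSpace ℝ _) (M + 1)).exists_isMinOn
    ⟨0, Metric.mem_closedBall_self (by linarith)⟩ (hσ.dist continuous_id).continuousOn
  obtain ⟨h, hh, hd, -⟩ := hσ.exists_contDiff_approx 1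
    (ε := fun _ => min 1 (dist (σ z) z)) continuous_const
    (fun _ => lt_min one_pos (dist_pos.2 (hne z)))
  have hn : ∀ x, ‖h x‖ < M + 1 := fun x => by
    have h1 := (hd x).trans_le (min_le_left _ _)
    rw [dist_eq_norm] at h1
    linarith [hM x, norm_le_norm_add_norm_sub' (h x) (σ x)]
  obtain ⟨x, hx⟩ := exists_fixedPoint_of_contDiff_of_norm_lt hh hn
  have h2 : dist (σ z) z ≤ dist (σ x) x := hz (by
    rw [mem_closedBall_zero_iff, ← hx]
    exact (hn x).le)
  have h3 := (hd x).trans_le (min_le_right _ _)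
  rw [hx, dist_comm] at h3
  exact h3.not_ge h2

end Brouwer

theorem lscAt_extend_image {V : Type*} [TopologicalSpace V] {C : Set V} (hC : IsClosed C)
    {F : C → Set C} (hF : ∀ x, LscAt F x) [DecidablePred (· ∈ C)] (x : V) :
    LscAt (fun x => if h : x ∈ C then Subtype.val '' F ⟨x, h⟩ else C) x := by
  intro Ω hΩ hne
  by_cases hx : x ∈ C
  · simp only [hx, dite_true] at hne
    obtain ⟨_, ⟨y, hy, rfl⟩, hyΩ⟩ := hne
    have h1 := hF ⟨x, hx⟩ _ (hΩ.preimage continuous_subtype_val) ⟨y, hy, hyΩ⟩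
    rw [nhds_subtype, eventually_comap] at h1
    filter_upwards [h1] with x' hx'
    by_cases h : x' ∈ C
    · simp only [h, dite_true]
      obtain ⟨z, hz, hzΩ⟩ := hx' ⟨x', h⟩ rfl
      exact ⟨z, mem_image_of_mem _ hz, hzΩ⟩
    · simp only [h, dite_false]
      exact ⟨y, y.2, hyΩ⟩
  · simp only [hx, dite_false] at hne
    filter_upwards [hC.isOpen_compl.mem_nhds hx] with x' hx'
    simpa only [show x' ∉ C from hx', dite_false] using hne

/-- Ky Fan minimax inequality: if `C ⊆ ℝⁿ` is nonempty convex compact, `f : C × C → ℝ`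
vanishes on the diagonal, and `F x := {y ∈ C : f x y < 0}` is lower semicontinuous and
convex-valued, then the equilibrium problem has a solution. -/
theorem kyFan_minimax {n : ℕ} {C : Set (Fin n → ℝ)}
    (hCne : C.Nonempty) (hCconv : Convex ℝ C) (hCcomp : IsCompact C)
    (f : C → C → ℝ) (hdiag : ∀ x : C, f x x = 0)
    (F : C → Set C) (hF : ∀ x : C, F x = {y : C | f x y < 0})
    (hFlsc : ∀ x : C, LscAt F x)
    (hFconv : ∀ x : C, Convex ℝ (Subtype.val '' F x)) :
    ∃ x : C, ∀ y : C, 0 ≤ f x y := by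
  classical
  by_contra! hneg
  obtain ⟨R, hR⟩ := hCcomp.isBounded.subset_closedBall 0
  let Φ : (Fin n → ℝ) → Set (Fin n → ℝ) := fun x =>
    if h : x ∈ C then Subtype.val '' F ⟨x, h⟩ else C
  have hΦ : ∀ x (h : x ∈ C), Φ x = Subtype.val '' F ⟨x, h⟩ := fun x h => dif_pos h
  have hΦ' : ∀ x, x ∉ C → Φ x = C := fun x h => dif_neg h
  have hsub : ∀ x, Φ x ⊆ C := fun x => by
    by_cases h : x ∈ C
    · rw [hΦ x h]
      exact Subtype.coe_image_subset _ _
    · rw [hΦ' x h]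
  obtain ⟨g, hg, hgΦ⟩ := exists_continuous_selection (Φ := Φ)
    (lscAt_extend_image hCcomp.isClosed hFlsc)
    (fun x => by
      by_cases h : x ∈ C
      · rw [hΦ x h]
        exact hFconv _
      · rwa [hΦ' x h])
    (fun x => by
      by_cases h : x ∈ C
      · rw [hΦ x h, hF]
        exact Nonempty.image _ (hneg ⟨x, h⟩)
      · rwa [hΦ' x h])
    (fun x => (hsub x).trans hR)
  obtain ⟨x, hx⟩ := exists_fixedPoint_of_continuous_of_norm_le hg
    (fun x => mem_closedBall_zero_iff.1 (hR (hsub x (hgΦ x))))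
  have hxΦ : x ∈ Φ x := by simpa only [hx] using hgΦ x
  have hxC : x ∈ C := hsub x hxΦ
  rw [hΦ x hxC] at hxΦ
  obtain ⟨y, hy, hyx⟩ := hxΦ
  have : y = ⟨x, hxC⟩ := Subtype.ext hyx
  rw [this, hF, mem_ofPred_eq, hdiag] at hy
  exact lt_irrefl _ hy
end
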